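/- arXiv:math/0501540 — 4 statements merged into one kernel-verified Lean document; each statement's English description precedes it below -/
import Mathlib

section
/- Let A be a commutative R-algebra equipped with a Poisson bracket and let I ⊆ A be a coisotropic ideal. For f ∈ I the map g ↦ {f,g} sends I into I and hence induces an R-linear derivation ρ(f) of the quotient ring A/I; moreover ρ(f) depends only on the class of f in I/I², and the resulting map ρ : I/I² → Der_R(A/I) is a homomorphism of Lie rings from I/I² with the bracket induced by the Poisson bracket to the derivations of A/I with the commutator bracket (i.e. ρ([f̄,ḡ]) = ρ(f̄)∘ρ(ḡ) − ρ(ḡ)∘ρ(f̄)). -/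
set_option maxHeartbeats 1000000

/-- For a coisotropic ideal `I` of a Poisson algebra `A`, each `f ∈ I` induces
a derivation `ρ(f)` of `A/I` (the class of `g ↦ {f,g}`); `ρ(f)` depends only on the class of
`f` in `I/I²`, and `ρ` is a homomorphism of Lie rings from `I/I²` (with the bracket induced by
the Poisson bracket) to the derivations of `A/I` with the commutator bracket. -/
theorem anchor_is_lie_ring_hom
    (R A : Type*) [CommRing R] [CommRing A] [Algebra R A]
    (br : A →ₗ[R] A →ₗ[R] A)
    (antisymm : ∀ f g : A, br f g = - br g f)
    (jacobi : ∀ f g h : A, br f (br g h) + br g (br h f) + br h (br f g) = 0)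
    (leibniz : ∀ f g h : A, br f (g * h) = br f g * h + g * br f h)
    (I : Ideal A)
    (coiso : ∀ h ∈ I, ∀ k ∈ I, br h k ∈ I) :
    -- for `f ∈ I` the map `g ↦ {f,g}` sends `I` into `I`:
    (∀ f ∈ I, ∀ g ∈ I, br f g ∈ I) ∧
    -- hence it induces a derivation `ρ(f)` of `A/I`:
    ∃ ρ : I → Derivation R (A ⧸ I) (A ⧸ I),
      (∀ (f : I) (g : A),
        ρ f (Ideal.Quotient.mk I g) = Ideal.Quotient.mk I (br (f : A) g)) ∧
      -- `ρ(f)` depends only on the class of `f` in `I/I²`: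
      (∀ f f' : I, (f : A) - (f' : A) ∈ I ^ 2 → ρ f = ρ f') ∧
      -- `ρ` is additive:
      (∀ f g : I, ρ (f + g) = ρ f + ρ g) ∧
      -- `ρ` sends the induced bracket on `I/I²` to the commutator of derivations:
      (∀ (f g : I) (hfg : br (f : A) (g : A) ∈ I) (x : A ⧸ I),
        ρ ⟨br (f : A) (g : A), hfg⟩ x = ρ f (ρ g x) - ρ g (ρ f x)) := by
  refine ⟨coiso, ?_⟩
  have hs : Function.Surjective (Ideal.Quotient.mk I) := Ideal.Quotient.mk_surjective
  have key : ∀ f : I, ∃ D : Derivation R (A ⧸ I) (A ⧸ I), ∀ g : A,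
      D (Ideal.Quotient.mk I g) = Ideal.Quotient.mk I (br (f : A) g) := by
    intro f
    let φ : A ⧸ I → A ⧸ I := fun x => Ideal.Quotient.mk I (br (f : A) (Function.surjInv hs x))
    have hφ : ∀ g : A, φ (Ideal.Quotient.mk I g) = Ideal.Quotient.mk I (br (f : A) g) := by
      intro g
      refine Ideal.Quotient.eq.mpr ?_
      rw [← map_sub]
      exact coiso _ f.2 _ (Ideal.Quotient.eq.mp (Function.surjInv_eq hs _))
    have hsm : ∀ (r : R) (a : A),
        r • Ideal.Quotient.mk I a = Ideal.Quotient.mk I (r • a) := fun _ _ => rfl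
    let L : (A ⧸ I) →ₗ[R] (A ⧸ I) :=
      { toFun := φ
        map_add' := by
          intro x y
          obtain ⟨a, rfl⟩ := hs x
          obtain ⟨b, rfl⟩ := hs y
          rw [← map_add, hφ, hφ, hφ, map_add, map_add]
        map_smul' := by
          intro r x
          obtain ⟨a, rfl⟩ := hs x
          rw [hsm, hφ, hφ, map_smul, RingHom.id_apply, hsm] }
    refine ⟨Derivation.mk' L ?_, hφ⟩
    intro x y
    obtain ⟨a, rfl⟩ := hs x
    obtain ⟨b, rfl⟩ := hs y
    change φ _ = _ • φ _ + _ • φ _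
    rw [← map_mul, hφ, hφ, hφ, leibniz, smul_eq_mul, smul_eq_mul, ← map_mul, ← map_mul,
      ← map_add]
    congr 1
    ring
  choose ρ hρ using key
  refine ⟨ρ, hρ, ?_, ?_, ?_⟩
  · intro f f' h
    have h2 : ∀ z ∈ I ^ 2, ∀ g : A, br z g ∈ I := by
      intro z hz g
      rw [pow_two] at hz
      induction hz using Submodule.mul_induction_on' with
      | mem_mul_mem a ha b hb =>
        rw [antisymm, leibniz]
        exact I.neg_mem (I.add_mem (I.mul_mem_left _ hb) (I.mul_mem_right _ ha))
      | add a _ b _ iha ihb =>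
        rw [map_add, LinearMap.add_apply]
        exact I.add_mem iha ihb
    ext x
    obtain ⟨a, rfl⟩ := hs x
    rw [hρ, hρ]
    refine Ideal.Quotient.eq.mpr ?_
    have := h2 _ h a
    rwa [map_sub, LinearMap.sub_apply] at this
  · intro f g
    ext x
    obtain ⟨a, rfl⟩ := hs x
    rw [Derivation.add_apply, hρ, hρ, hρ, ← map_add, Submodule.coe_add, map_add,
      LinearMap.add_apply]
  · intro f g hfg x
    obtain ⟨a, rfl⟩ := hs x
    rw [hρ, hρ, hρ, hρ, hρ, ← map_sub]
    congr 1
    have h1 := jacobi f g a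
    have h3 := antisymm a (br (f : A) (g : A))
    have h4 := antisymm a (f : A)
    rw [h3, h4, map_neg] at h1
    linear_combination -h1
end

section
/- Let R be a commutative ring, A a commutative R-algebra, n ≥ 1, and φ : A^n → A an R-multilinear map which is alternating (φ vanishes whenever two adjacent arguments are equal, equivalently φ(…,a_i,a_{i+1},…) = −φ(…,a_{i+1},a_i,…)) and is a derivation in each argument (φ(a_1,…,a_{i-1}, a·b, a_{i+1},…,a_n) = a·φ(…,b,…) + b·φ(…,a,…)). Then φ is a Hochschild cocycle: bφ = 0. -/
/-- The Hochschild differential of an `n`-cochain `φ` with respect to the product `μ`: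
`(bφ)(a₁,…,a_{n+1}) = a₁·φ(a₂,…,a_{n+1}) + Σ_{j=1}^{n} (−1)^j φ(a₁,…,a_j·a_{j+1},…,a_{n+1})
  + (−1)^{n+1} φ(a₁,…,a_n)·a_{n+1}` (indices written `0`-based). -/
def hochschildB {M : Type*} [AddCommGroup M] (μ : M → M → M) (n : ℕ)
    (φ : (Fin n → M) → M) : (Fin (n + 1) → M) → M :=
  fun a =>
    μ (a 0) (φ fun i => a i.succ) +
    ∑ j : Fin n, ((-1 : ℤ) ^ ((j : ℕ) + 1)) •
      φ (fun i =>
        if (i : ℕ) < (j : ℕ) then a i.castSucc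
        else if (i : ℕ) = (j : ℕ) then μ (a i.castSucc) (a i.succ)
        else a i.succ) +
    ((-1 : ℤ) ^ (n + 1)) • μ (φ fun i => a i.castSucc) (a (Fin.last n))

/-- An alternating `R`-multilinear map `φ : Aⁿ → A` (`n ≥ 1`) on a commutative
`R`-algebra `A` which is a derivation in each argument is a Hochschild cocycle: `bφ = 0`. -/
theorem hkr_cochain_is_cocycle
    (R A : Type*) [CommRing R] [CommRing A] [Algebra R A]
    (n : ℕ) (hn : 1 ≤ n)
    (φ : AlternatingMap R A A (Fin n))
    (deriv : ∀ (a : Fin n → A) (i : Fin n) (x y : A),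
      φ (Function.update a i (x * y)) =
        x * φ (Function.update a i y) + y * φ (Function.update a i x)) :
    ∀ a : Fin (n + 1) → A, hochschildB (· * ·) n (⇑φ) a = 0 := by
  intro a
  have key : ∀ j : Fin n, φ (fun i : Fin n =>
        if (i : ℕ) < (j : ℕ) then a i.castSucc
        else if (i : ℕ) = (j : ℕ) then a i.castSucc * a i.succ
        else a i.succ) =
      a j.castSucc * φ (fun i => a (j.castSucc.succAbove i)) +
        a j.succ * φ (fun i => a (j.succ.succAbove i)) := by
    intro j
    have h := deriv (fun i => a (j.castSucc.succAbove i)) j (a j.castSucc) (a j.succ)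
    have h1 : Function.update (fun i => a (j.castSucc.succAbove i)) j
        (a j.castSucc * a j.succ) = (fun i : Fin n =>
        if (i : ℕ) < (j : ℕ) then a i.castSucc
        else if (i : ℕ) = (j : ℕ) then a i.castSucc * a i.succ
        else a i.succ) := by
      funext i
      by_cases hij : i = j
      · subst hij; simp
      · have hne : (i : ℕ) ≠ j := fun h => hij (Fin.ext h)
        simp only [Function.update_of_ne hij, Fin.succAbove, Fin.lt_def, Fin.val_castSucc,
          if_neg hne]
        split_ifs <;> rfl
    have h2 : Function.update (fun i => a (j.castSucc.succAbove i)) j (a j.succ) =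
        fun i => a (j.castSucc.succAbove i) := by
      rw [Function.update_eq_self_iff]
      simp
    have h3 : Function.update (fun i => a (j.castSucc.succAbove i)) j (a j.castSucc) =
        fun i => a (j.succ.succAbove i) := by
      funext i
      by_cases hij : i = j
      · subst hij; simp
      · have hne : (i : ℕ) ≠ j := fun h => hij (Fin.ext h)
        simp only [Function.update_of_ne hij, Fin.succAbove, Fin.lt_def, Fin.val_castSucc,
          Fin.val_succ]
        split_ifs <;> first | rfl | omega
    rw [h1, h2, h3] at h
    exact h
  let G : Fin (n + 1) → A := fun k => (-1) ^ (k : ℕ) * (a k * φ (fun i => a (k.succAbove i)))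
  have hs := Fin.sum_univ_succ G
  rw [Fin.sum_univ_castSucc G] at hs
  have hsum : (∑ j : Fin n, ((-1 : ℤ) ^ ((j : ℕ) + 1)) •
      φ (fun i : Fin n =>
        if (i : ℕ) < (j : ℕ) then a i.castSucc
        else if (i : ℕ) = (j : ℕ) then a i.castSucc * a i.succ
        else a i.succ)) = ∑ j : Fin n, G j.succ - ∑ j : Fin n, G j.castSucc := by
    rw [← Finset.sum_sub_distrib]
    refine Finset.sum_congr rfl fun j _ => ?_
    rw [key j, zsmul_eq_mul]
    simp only [G, Fin.val_succ, Fin.val_castSucc]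
    push_cast
    ring
  have h0 : G 0 = a 0 * φ (fun i => a i.succ) := by simp [G]
  have hl : ((-1 : ℤ) ^ (n + 1)) • (φ (fun i => a i.castSucc) * a (Fin.last n)) =
      - G (Fin.last n) := by
    rw [zsmul_eq_mul]
    simp only [G, Fin.succAbove_last, Fin.val_last]
    push_cast
    ring
  unfold hochschildB
  simp only []
  rw [hsum, hl, ← h0]
  linear_combination -hs
end

section
/- Let R be a commutative ring, A a commutative R-algebra, p ≥ 0, and φ : A^p → A any R-multilinear map. Then the full alternation of the Hochschild coboundary of φ vanishes: for all a_1, …, a_{p+1} ∈ A, Σ_{σ ∈ S_{p+1}} sign(σ) (bφ)(a_{σ(1)}, …, a_{σ(p+1)}) = 0. -/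
/-- For any `R`-multilinear `p`-cochain `φ` on a commutative `R`-algebra `A`,
the full alternation of its Hochschild coboundary vanishes:
`Σ_{σ ∈ S_{p+1}} sign(σ) (bφ)(a_{σ(1)}, …, a_{σ(p+1)}) = 0`. -/
theorem alternation_of_coboundary_vanishes
    (R A : Type*) [CommRing R] [CommRing A] [Algebra R A]
    (p : ℕ) (φ : MultilinearMap R (fun _ : Fin p => A) A) :
    ∀ a : Fin (p + 1) → A,
      ∑ σ : Equiv.Perm (Fin (p + 1)),
        ((Equiv.Perm.sign σ : ℤˣ) : ℤ) •
          hochschildB (· * ·) p (⇑φ) (fun i => a (σ i)) = 0 := by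
  intro a
  simp only [hochschildB, smul_add, Finset.sum_add_distrib, Finset.smul_sum]
  -- the inner terms cancel in pairs
  have hmid : ∑ σ : Equiv.Perm (Fin (p + 1)), ∑ j : Fin p,
      ((Equiv.Perm.sign σ : ℤˣ) : ℤ) • ((-1 : ℤ) ^ ((j : ℕ) + 1)) •
      φ (fun i =>
        if (i : ℕ) < (j : ℕ) then a (σ i.castSucc)
        else if (i : ℕ) = (j : ℕ) then a (σ i.castSucc) * a (σ i.succ)
        else a (σ i.succ)) = 0 := by
    rw [Finset.sum_comm]
    refine Finset.sum_eq_zero fun j _ => ?_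
    have hne : j.castSucc ≠ j.succ := (Fin.castSucc_lt_succ).ne
    refine Finset.sum_involution (fun σ _ => σ * Equiv.swap j.castSucc j.succ) ?_ ?_ ?_ ?_
    · intro σ _
      have harg : (fun i : Fin p =>
          if (i : ℕ) < (j : ℕ) then a ((σ * Equiv.swap j.castSucc j.succ) i.castSucc)
          else if (i : ℕ) = (j : ℕ) then a ((σ * Equiv.swap j.castSucc j.succ) i.castSucc) *
            a ((σ * Equiv.swap j.castSucc j.succ) i.succ)
          else a ((σ * Equiv.swap j.castSucc j.succ) i.succ)) = (fun i : Fin p =>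
          if (i : ℕ) < (j : ℕ) then a (σ i.castSucc)
          else if (i : ℕ) = (j : ℕ) then a (σ i.castSucc) * a (σ i.succ)
          else a (σ i.succ)) := by
        funext i
        simp only [Equiv.Perm.mul_apply]
        split_ifs with h1 h2
        · rw [Equiv.swap_apply_of_ne_of_ne] <;>
            · intro h
              have := congrArg Fin.val h
              simp at this
              omega
        · obtain rfl : i = j := Fin.ext h2
          rw [Equiv.swap_apply_left, Equiv.swap_apply_right, mul_comm]
        · rw [Equiv.swap_apply_of_ne_of_ne] <;>
            · intro h
              have := congrArg Fin.val h
              simp at this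
              omega
      rw [harg, Equiv.Perm.sign_mul, Equiv.Perm.sign_swap hne]
      simp
    · intro σ _ _ h
      exact hne (Equiv.swap_eq_one_iff.mp (mul_eq_left.mp h))
    · intro σ _
      exact Finset.mem_univ _
    · intro σ _
      simp [mul_assoc]
  -- the last term cancels the first after a cyclic rotation
  have hlast : ∑ σ : Equiv.Perm (Fin (p + 1)), ((Equiv.Perm.sign σ : ℤˣ) : ℤ) •
      ((-1 : ℤ) ^ (p + 1)) • ((φ fun i => a (σ i.castSucc)) * a (σ (Fin.last p))) =
      - ∑ σ : Equiv.Perm (Fin (p + 1)), ((Equiv.Perm.sign σ : ℤˣ) : ℤ) •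
      (a (σ 0) * (φ fun i => a (σ i.succ))) := by
    rw [← Finset.sum_neg_distrib, ← Equiv.sum_comp (Equiv.mulRight (finRotate (p + 1)))]
    refine Finset.sum_congr rfl fun σ _ => ?_
    have hs : ((-1 : ℤ) ^ p) * (-1 : ℤ) ^ (p + 1) = -1 := by
      rw [← pow_add]
      exact Odd.neg_one_pow ⟨p, by ring⟩
    have hr : ∀ i : Fin p, finRotate (p + 1) i.castSucc = i.succ := fun i => by
      simp
    simp only [Equiv.coe_mulRight, Equiv.Perm.mul_apply, hr, finRotate_last,
      Equiv.Perm.sign_mul, sign_finRotate]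
    push_cast
    rw [smul_smul, mul_assoc, hs, mul_comm (a (σ 0))]
    simp
  rw [hmid, hlast]
  simp
end

section
/- Let R be a commutative ring, A a commutative R-algebra, and D_1, …, D_n R-linear derivations of A. Define the multilinear map φ : A^n → A by φ(a_1,…,a_n) = Σ_{σ ∈ S_n} sign(σ) · D_{σ(1)}(a_1) · D_{σ(2)}(a_2) ⋯ D_{σ(n)}(a_n). Then φ is alternating, is a derivation in each of its arguments, and satisfies bφ = 0 for the Hochschild differential b. -/
theorem hkr_leibniz_aux
    {R A : Type*} [CommRing R] [CommRing A] [Algebra R A]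
    {n : ℕ} (D : Fin n → Derivation R A A) (a : Fin n → A) (i : Fin n) (x y : A) :
    (Matrix.of fun k l => D k (Function.update a i (x * y) l)).det =
      x * (Matrix.of fun k l => D k (Function.update a i y l)).det +
      y * (Matrix.of fun k l => D k (Function.update a i x l)).det := by
  have key : ∀ z : A, (Matrix.of fun k l => D k (Function.update a i z l)) =
      (Matrix.of fun k l => D k (a l)).updateCol i (fun k => D k z) := by
    intro z
    ext k l
    by_cases h : l = i
    · subst h; simp
    · simp [h]
  rw [key, key, key, ← Matrix.det_updateCol_smul, ← Matrix.det_updateCol_smul,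
    ← Matrix.det_updateCol_add]
  congr 2
  ext k
  simp

theorem hkr_cocycle_aux {A : Type*} [CommRing A] (n : ℕ) (φ : (Fin n → A) → A)
    (hφ : ∀ (a : Fin n → A) (i : Fin n) (x y : A),
      φ (Function.update a i (x * y)) =
        x * φ (Function.update a i y) + y * φ (Function.update a i x))
    (a : Fin (n + 1) → A) : hochschildB (· * ·) n φ a = 0 := by
  let s : Fin (n + 1) → A := fun k => (-1) ^ (k : ℕ) * (a k * φ (fun i => a (k.succAbove i)))
  have hterm : ∀ j : Fin n, ((-1 : ℤ) ^ ((j : ℕ) + 1)) •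
      φ (fun i =>
        if (i : ℕ) < (j : ℕ) then a i.castSucc
        else if (i : ℕ) = (j : ℕ) then a i.castSucc * a i.succ
        else a i.succ) = s j.succ - s j.castSucc := by
    intro j
    have h0 : (fun i : Fin n =>
        if (i : ℕ) < (j : ℕ) then a i.castSucc
        else if (i : ℕ) = (j : ℕ) then a i.castSucc * a i.succ
        else a i.succ) = Function.update (fun i => a (j.castSucc.succAbove i)) j
          (a j.castSucc * a j.succ) := by
      ext i
      by_cases h : i = j
      · subst h; simp
      · have h' : (i : ℕ) ≠ j := fun e => h (Fin.ext e)
        simp only [Function.update_of_ne h, h', if_false, Fin.succAbove, Fin.lt_def,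
          Fin.val_castSucc]
        split_ifs <;> rfl
    have h1 : Function.update (fun i => a (j.castSucc.succAbove i)) j (a j.succ) =
        fun i => a (j.castSucc.succAbove i) := by
      ext i
      by_cases h : i = j
      · subst h; simp
      · simp [h]
    have h2 : Function.update (fun i => a (j.castSucc.succAbove i)) j (a j.castSucc) =
        fun i => a (j.succ.succAbove i) := by
      ext i
      by_cases h : i = j
      · subst h; simp
      · have h' : (i : ℕ) ≠ j := fun e => h (Fin.ext e)
        have h3 : (i : ℕ) < j + 1 ↔ (i : ℕ) < j := by omega
        simp only [Function.update_of_ne h, Fin.succAbove, Fin.lt_def,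
          Fin.val_castSucc, Fin.val_succ, h3]
    rw [h0, hφ, h1, h2]
    simp only [s, Fin.val_castSucc, Fin.val_succ, zsmul_eq_mul]
    push_cast
    ring
  have hsum : ∑ j : Fin n, (s j.succ - s j.castSucc) = s (Fin.last n) - s 0 := by
    rw [Finset.sum_sub_distrib]
    have e1 := Fin.sum_univ_succ s
    have e2 := Fin.sum_univ_castSucc s
    linear_combination e2 - e1
  simp only [hochschildB]
  rw [Finset.sum_congr rfl (fun j _ => hterm j), hsum]
  simp only [s, Fin.succAbove_last, Fin.succAbove_zero, Fin.val_last, Fin.val_zero, zsmul_eq_mul]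
  push_cast
  ring

/-- For derivations `D₁, …, D_n` of a commutative `R`-algebra `A`, the map
`φ(a₁,…,a_n) = Σ_{σ ∈ S_n} sign(σ) D_{σ(1)}(a₁) ⋯ D_{σ(n)}(a_n)` is alternating, a derivation
in each argument, and a Hochschild cocycle (`bφ = 0`).  (This is the HKR map.) -/
theorem hkr_image_is_cocycle
    (R A : Type*) [CommRing R] [CommRing A] [Algebra R A]
    (n : ℕ) (D : Fin n → Derivation R A A) :
    let φ : (Fin n → A) → A := fun a =>
      ∑ σ : Equiv.Perm (Fin n),
        ((Equiv.Perm.sign σ : ℤˣ) : ℤ) • ∏ i : Fin n, D (σ i) (a i)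
    -- alternating:
    (∀ (a : Fin n → A) (i j : Fin n), i ≠ j → a i = a j → φ a = 0) ∧
    -- a derivation in each argument:
    (∀ (a : Fin n → A) (i : Fin n) (x y : A),
      φ (Function.update a i (x * y)) =
        x * φ (Function.update a i y) + y * φ (Function.update a i x)) ∧
    -- a Hochschild cocycle:
    (∀ a : Fin (n + 1) → A, hochschildB (· * ·) n φ a = 0) := by
  intro φ
  have hdet : ∀ a, φ a = (Matrix.of fun k l => D k (a l)).det := by
    intro a
    rw [Matrix.det_apply]
    rfl
  have hL : ∀ (a : Fin n → A) (i : Fin n) (x y : A),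
      φ (Function.update a i (x * y)) =
        x * φ (Function.update a i y) + y * φ (Function.update a i x) := by
    intro a i x y
    rw [hdet, hdet, hdet]
    exact hkr_leibniz_aux D a i x y
  refine ⟨?_, hL, hkr_cocycle_aux n φ hL⟩
  intro a i j hij h
  rw [hdet]
  exact Matrix.det_zero_of_column_eq hij (fun k => by simp [h])
end
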